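/- Convergence of the decomposed dual consensus ADMM (Proposition 2). Let σ > 0, ρ > 0 and let initial values y_i^0, z_i^0, s_i^0 ∈ ℝ^m and p_i^0 = 0 be given for each i ∈ 𝒩. Suppose the sequences (p_i^k), (s_i^k), (r_i^k), (x_i^k), (y_i^k), (z_i^k) satisfy, for every k ≥ 0 and every i ∈ 𝒩: p_i^{k+1} = p_i^k + ρ ∑_{j∈𝒩_i} (y_i^k − y_j^k); s_i^{k+1} = s_i^k + σ (y_i^k − z_i^k); r_i^{k+1} = σ z_i^k + ρ ∑_{j∈𝒩_i} (y_i^k + y_j^k) − (b_i + p_i^{k+1} + s_i^{k+1}); x_i^{k+1} is a global minimizer over x_i ∈ ℝ^{n_i} of f_i(x_i) + (1/(2(σ + 2 ρ d_i))) ‖A_i x_i + r_i^{k+1}‖²; y_i^{k+1} = (A_i x_i^{k+1} + r_i^{k+1})/(σ + 2 ρ d_i); and z_i^{k+1} = Π_{K∘}(y_i^{k+1} + (1/σ) s_i^{k+1}). Then there exists y* maximizing the dual problem (D) such that y_i^k → y* and z_i^k → y* as k → ∞ for every i ∈ 𝒩, and every limit point of the sequence of concatenated vectors ((x_i^k)_{i∈𝒩})_{k∈ℕ}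 in ℝ^n is a minimizer of the primal problem (P). -/

import Mathlib

open Filter Topology RealInnerProductSpace

open Classical in
/-- Euclidean projection onto a set (well-defined on nonempty closed convex sets). -/
noncomputable def projSet {E : Type*} [NormedAddCommGroup E] [InnerProductSpace ℝ E]
    (C : Set E) (z : E) : E :=
  if h : ∃ p ∈ C, ∀ q ∈ C, ‖z - p‖ ≤ ‖z - q‖ then h.choose else z

/-- Polar cone of a set. -/
def polarSet {E : Type*} [NormedAddCommGroup E] [InnerProductSpace ℝ E] (C : Set E) : Set E :=
  {y | ∀ x ∈ C, ⟪x, y⟫ ≤ 0}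

/-- Normal cone of a convex set `C` at a point `x`. -/
def nCone {E : Type*} [NormedAddCommGroup E] [InnerProductSpace ℝ E]
    (C : Set E) (x : E) : Set E :=
  {u | ∀ w ∈ C, ⟪u, w - x⟫ ≤ 0}

/-- Convex (Fenchel) conjugate of an extended-real-valued function. -/
noncomputable def econj {E : Type*} [NormedAddCommGroup E] [InnerProductSpace ℝ E]
    (f : E → EReal) (y : E) : EReal :=
  ⨆ x, ((⟪y, x⟫ : ℝ) : EReal) - f x

open Classical in
/-- Extended-real-valued indicator function of a set. -/
noncomputable def eindicator {E : Type*} (C : Set E) (y : E) : EReal :=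
  if y ∈ C then 0 else ⊤

/-- Subdifferential of an extended-real-valued function. -/
def ESubdiff {E : Type*} [NormedAddCommGroup E] [InnerProductSpace ℝ E]
    (f : E → EReal) (x : E) : Set E :=
  {u | ∀ v, f x + ((⟪u, v - x⟫ : ℝ) : EReal) ≤ f v}

/-- Convexity of an extended-real-valued function. -/
def EConvexFn {E : Type*} [AddCommMonoid E] [Module ℝ E] (f : E → EReal) : Prop :=
  ∀ x y : E, ∀ a b : ℝ, 0 ≤ a → 0 ≤ b → a + b = 1 →
    f (a • x + b • y) ≤ (a : EReal) * f x + (b : EReal) * f y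

/-- Properness of an extended-real-valued function. -/
def EProper {E : Type*} (f : E → EReal) : Prop :=
  (∀ x, f x ≠ ⊥) ∧ ∃ x, f x ≠ ⊤

section ConsensusADMM

variable {E N : Type*} [NormedAddCommGroup E]

lemma tendsto_zero_of_sq_norm_le {a : ℕ → E} {c : ℝ} {e : ℕ → ℝ}
    (hle : ∀ k, ‖a k‖ ^ 2 ≤ c * e k) (he : Tendsto e atTop (𝓝 0)) :
    Tendsto a atTop (𝓝 0) := by
  rw [tendsto_zero_iff_norm_tendsto_zero]
  have h1 : Tendsto (fun k => ‖a k‖ ^ 2) atTop (𝓝 0) :=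
    squeeze_zero (fun k => by positivity) hle (by simpa using he.const_mul c)
  simpa using h1.sqrt

lemma exists_norm_le_of_sq_norm_sub_le {a : ℕ → E} {abar : E} {c : ℝ}
    (hle : ∀ k, ‖a k - abar‖ ^ 2 ≤ c) : ∃ C, ∀ k, ‖a k‖ ≤ C :=
  ⟨√c + ‖abar‖, fun k => by
    have h1 := Real.le_sqrt_of_sq_le (hle k)
    have h2 := norm_sub_norm_le (a k) abar
    linarith⟩

lemma SimpleGraph.Connected.tendsto_sub_zero {G : SimpleGraph N} (hG : G.Connected)
    {Y : ℕ → N → E}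
    (hY : ∀ i j, G.Adj i j → Tendsto (fun k => Y k i - Y k j) atTop (𝓝 0)) (i j : N) :
    Tendsto (fun k => Y k i - Y k j) atTop (𝓝 0) := by
  obtain ⟨W⟩ := hG.preconnected i j
  induction W with
  | nil => simp
  | cons h _ ih => simpa using (hY _ _ h).add ih

variable [Fintype N]

lemma SimpleGraph.sum_neighborFinset_comm {M : Type*} [AddCommMonoid M] (G : SimpleGraph N)
    [DecidableRel G.Adj] (g : N → N → M) :
    ∑ i, ∑ j ∈ G.neighborFinset i, g i j = ∑ i, ∑ j ∈ G.neighborFinset i, g j i := by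
  refine Finset.sum_comm' fun i j => ?_
  simp [G.adj_comm]

/-- On a connected graph, every balanced supply vector is the divergence of a flow. -/
lemma SimpleGraph.Connected.exists_flow {G : SimpleGraph N} [DecidableRel G.Adj]
    {M : Type*} [AddCommGroup M] (hG : G.Connected) (p : N → M) (hp : ∑ i, p i = 0) :
    ∃ F : N → N → M, (∀ i j, F i j = -F j i) ∧ ∀ i, ∑ j ∈ G.neighborFinset i, F i j = p i := by
  classical
  have key : ∀ u v : N, G.Reachable u v → ∀ w : M, ∃ F : N → N → M,
      (∀ i j, F i j = -F j i) ∧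
        ∀ i, ∑ j ∈ G.neighborFinset i, F i j = (Pi.single u w - Pi.single v w : N → M) i := by
    rintro u v ⟨W⟩ w
    induction W with
    | nil => exact ⟨fun _ _ => 0, by simp, by simp⟩
    | @cons a c d h W ih =>
      obtain ⟨F, hF, hdiv⟩ := ih
      have hne : a ≠ c := h.ne
      refine ⟨fun i j => F i j + ((if i = a ∧ j = c then w else 0) -
        (if i = c ∧ j = a then w else 0)), fun i j => ?_, fun i => ?_⟩
      · simp only [hF i j, and_comm (a := i = a), and_comm (a := i = c)]
        abel
      · rw [Finset.sum_add_distrib, hdiv, Finset.sum_sub_distrib]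
        have e1 : ∑ j ∈ G.neighborFinset i, (if i = a ∧ j = c then w else 0)
            = (Pi.single a w : N → M) i := by
          by_cases hi : i = a
          · subst hi
            simp [h]
          · simp [hi]
        have e2 : ∑ j ∈ G.neighborFinset i, (if i = c ∧ j = a then w else 0)
            = (Pi.single c w : N → M) i := by
          by_cases hi : i = c
          · subst hi
            simp [h.symm]
          · simp [hi]
        rw [e1, e2]
        simp only [Pi.sub_apply]
        abel
  obtain ⟨o⟩ := hG.nonempty
  choose F hF hdiv using fun u : N => key u o (hG.preconnected u o) (p u)
  refine ⟨fun i j => ∑ u, F u i j, fun i j => ?_, fun i => ?_⟩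
  · rw [← Finset.sum_neg_distrib]
    exact Finset.sum_congr rfl fun u _ => hF u i j
  · rw [Finset.sum_comm]
    simp only [hdiv, Pi.sub_apply, Finset.sum_sub_distrib]
    rw [Finset.sum_pi_single]
    have : ∑ u, (Pi.single o (p u) : N → M) i = (Pi.single o (∑ u, p u) : N → M) i := by
      by_cases hi : i = o
      · subst hi; simp
      · simp [hi]
    rw [this, hp]
    simp

/-- Weighted squared size of a state; distances to stationary points measured in this energy
decrease along the iteration. -/
noncomputable def consensusEnergy (G : SimpleGraph N) [DecidableRel G.Adj] (σ ρ : ℝ)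
    (y z s : N → E) (F : N → N → E) : ℝ :=
  ∑ i, (1 / (2 * σ) * ‖s i‖ ^ 2 + σ / 2 * ‖z i‖ ^ 2)
    + ∑ i, ∑ j ∈ G.neighborFinset i, (1 / (4 * ρ) * ‖F i j‖ ^ 2
      + ρ / 4 * ‖y i + y j‖ ^ 2)

variable {G : SimpleGraph N} [DecidableRel G.Adj] {σ ρ : ℝ}

lemma consensusEnergy_nonneg (hσ : 0 < σ) (hρ : 0 < ρ) (y z s : N → E) (F : N → N → E) :
    0 ≤ consensusEnergy G σ ρ y z s F := by
  unfold consensusEnergy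
  positivity

lemma sq_norm_node_le_consensusEnergy (hσ : 0 < σ) (hρ : 0 < ρ) (y z s : N → E)
    (F : N → N → E) (i : N) :
    1 / (2 * σ) * ‖s i‖ ^ 2 + σ / 2 * ‖z i‖ ^ 2 ≤ consensusEnergy G σ ρ y z s F := by
  unfold consensusEnergy
  have h1 := Finset.single_le_sum
    (f := fun i => 1 / (2 * σ) * ‖s i‖ ^ 2 + σ / 2 * ‖z i‖ ^ 2)
    (fun i _ => by positivity) (Finset.mem_univ i)
  have h2 : 0 ≤ ∑ i, ∑ j ∈ G.neighborFinset i, (1 / (4 * ρ) * ‖F i j‖ ^ 2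
      + ρ / 4 * ‖y i + y j‖ ^ 2) := by positivity
  linarith

lemma sq_norm_z_le_consensusEnergy (hσ : 0 < σ) (hρ : 0 < ρ) (y z s : N → E)
    (F : N → N → E) (i : N) :
    ‖z i‖ ^ 2 ≤ 2 / σ * consensusEnergy G σ ρ y z s F := by
  have h := sq_norm_node_le_consensusEnergy (G := G) hσ hρ y z s F i
  have h0 : 0 ≤ 1 / (2 * σ) * ‖s i‖ ^ 2 := by positivity
  calc ‖z i‖ ^ 2 = 2 / σ * (σ / 2 * ‖z i‖ ^ 2) := by field_simp
    _ ≤ _ := by gcongr; linarith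

lemma sq_norm_s_le_consensusEnergy (hσ : 0 < σ) (hρ : 0 < ρ) (y z s : N → E)
    (F : N → N → E) (i : N) :
    ‖s i‖ ^ 2 ≤ 2 * σ * consensusEnergy G σ ρ y z s F := by
  have h := sq_norm_node_le_consensusEnergy (G := G) hσ hρ y z s F i
  have h0 : 0 ≤ σ / 2 * ‖z i‖ ^ 2 := by positivity
  calc ‖s i‖ ^ 2 = 2 * σ * (1 / (2 * σ) * ‖s i‖ ^ 2) := by field_simp
    _ ≤ _ := by gcongr; linarith

lemma sq_norm_flow_le_consensusEnergy (hσ : 0 < σ) (hρ : 0 < ρ) (y z s : N → E)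
    (F : N → N → E) {i j : N} (hij : G.Adj i j) :
    ‖F i j‖ ^ 2 ≤ 4 * ρ * consensusEnergy G σ ρ y z s F := by
  have h1 := Finset.single_le_sum (f := fun i => ∑ j ∈ G.neighborFinset i,
    (1 / (4 * ρ) * ‖F i j‖ ^ 2 + ρ / 4 * ‖y i + y j‖ ^ 2))
    (fun i _ => by positivity) (Finset.mem_univ i)
  have h2 := Finset.single_le_sum (f := fun j => 1 / (4 * ρ) * ‖F i j‖ ^ 2
    + ρ / 4 * ‖y i + y j‖ ^ 2) (fun j _ => by positivity)
    ((G.mem_neighborFinset i j).2 hij)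
  have h3 : 0 ≤ ∑ i, (1 / (2 * σ) * ‖s i‖ ^ 2 + σ / 2 * ‖z i‖ ^ 2) := by positivity
  have h4 : 0 ≤ ρ / 4 * ‖y i + y j‖ ^ 2 := by positivity
  have h5 : 1 / (4 * ρ) * ‖F i j‖ ^ 2 ≤ consensusEnergy G σ ρ y z s F := by
    unfold consensusEnergy
    linarith
  calc ‖F i j‖ ^ 2 = 4 * ρ * (1 / (4 * ρ) * ‖F i j‖ ^ 2) := by field_simp
    _ ≤ _ := by gcongr

lemma tendsto_consensusEnergy_zero {y z s : ℕ → N → E} {F : ℕ → N → N → E}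
    (hy : ∀ i, Tendsto (fun k => y k i) atTop (𝓝 0))
    (hz : ∀ i, Tendsto (fun k => z k i) atTop (𝓝 0))
    (hs : ∀ i, Tendsto (fun k => s k i) atTop (𝓝 0))
    (hF : ∀ i j, Tendsto (fun k => F k i j) atTop (𝓝 0)) :
    Tendsto (fun k => consensusEnergy G σ ρ (y k) (z k) (s k) (F k)) atTop (𝓝 0) := by
  have h1 := (tendsto_finsetSum Finset.univ fun i _ =>
      ((((hs i).norm.pow 2).const_mul (1 / (2 * σ))).add
        (((hz i).norm.pow 2).const_mul (σ / 2)))).add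
    (tendsto_finsetSum Finset.univ fun i _ => tendsto_finsetSum (G.neighborFinset i) fun j _ =>
      ((((hF i j).norm.pow 2).const_mul (1 / (4 * ρ))).add
        ((((hy i).add (hy j)).norm.pow 2).const_mul (ρ / 4))))
  simpa [consensusEnergy] using h1

variable [InnerProductSpace ℝ E]

lemma two_mul_inner_sub_sub (a b c : E) :
    2 * ⟪a - b, a - c⟫ = ‖a - c‖ ^ 2 - ‖b - c‖ ^ 2 + ‖a - b‖ ^ 2 := by
  have h : b - c = (a - c) - (a - b) := by abel
  rw [h, norm_sub_sq_real (a - c) (a - b), real_inner_comm]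
  ring

/-- Variational characterization of the projection onto a closed convex cone. -/
lemma projSet_cone_spec [CompleteSpace E] {C : Set E} (hne : C.Nonempty) (hcl : IsClosed C)
    (hconv : Convex ℝ C) (hcone : ∀ c : ℝ, 0 < c → ∀ x ∈ C, c • x ∈ C) (w : E) :
    projSet C w ∈ C ∧ ⟪w - projSet C w, projSet C w⟫ = 0 ∧
      ∀ q ∈ C, ⟪w - projSet C w, q⟫ ≤ 0 := by
  have hex : ∃ p ∈ C, ∀ q ∈ C, ‖w - p‖ ≤ ‖w - q‖ := by
    obtain ⟨v, hv, hv'⟩ := exists_norm_eq_iInf_of_complete_convex hne hcl.isComplete hconv w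
    refine ⟨v, hv, fun q hq => ?_⟩
    rw [hv']
    exact ciInf_le ⟨0, by rintro _ ⟨x, rfl⟩; positivity⟩ (⟨q, hq⟩ : C)
  have hP : projSet C w ∈ C ∧ ∀ q ∈ C, ‖w - projSet C w‖ ≤ ‖w - q‖ := by
    unfold projSet
    rw [dif_pos hex]
    exact hex.choose_spec
  obtain ⟨hPC, hPmin⟩ := hP
  set P := projSet C w
  have hinf : ‖w - P‖ = ⨅ q : C, ‖w - q‖ := by
    have : Nonempty C := hne.to_subtype
    exact le_antisymm (le_ciInf fun q => hPmin q q.2)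
      (ciInf_le ⟨0, by rintro _ ⟨x, rfl⟩; positivity⟩ (⟨P, hPC⟩ : C))
  have hvar := (norm_eq_iInf_iff_real_inner_le_zero hconv hPC).1 hinf
  have h2 := hvar _ (hcone 2 (by norm_num) P hPC)
  have h1 := hvar _ (hcone (1 / 2) (by norm_num) P hPC)
  simp only [inner_sub_right, inner_smul_right] at h1 h2
  have h0 : ⟪w - P, P⟫ = 0 := by linarith
  refine ⟨hPC, h0, fun q hq => ?_⟩
  have := hvar q hq
  rw [inner_sub_right] at this
  linarith

/-- Bipolar theorem for closed convex cones. -/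
lemma mem_of_forall_polarSet_inner_nonpos [CompleteSpace E] {C : Set E} (hne : C.Nonempty)
    (hcl : IsClosed C) (hconv : Convex ℝ C) (hcone : ∀ c : ℝ, 0 < c → ∀ x ∈ C, c • x ∈ C)
    {w : E} (hw : ∀ q ∈ polarSet C, ⟪w, q⟫ ≤ 0) : w ∈ C := by
  obtain ⟨hP, h0, hle⟩ := projSet_cone_spec hne hcl hconv hcone w
  have h1 := hw (w - projSet C w) fun q hq => by
    rw [real_inner_comm]; exact hle q hq
  have h2 : ⟪w - projSet C w, w - projSet C w⟫ ≤ 0 := by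
    rw [inner_sub_right, h0, real_inner_comm]; linarith
  have h3 : w - projSet C w = 0 := by
    rw [real_inner_self_eq_norm_sq] at h2
    have : ‖w - projSet C w‖ = 0 := by nlinarith [norm_nonneg (w - projSet C w)]
    exact norm_eq_zero.1 this
  rw [sub_eq_zero.1 h3]
  exact hP

lemma isClosed_polarSet (C : Set E) : IsClosed (polarSet C) := by
  have : polarSet C = ⋂ x ∈ C, {y | ⟪x, y⟫ ≤ 0} := by
    ext y; simp [polarSet]
  rw [this]
  exact isClosed_biInter fun x _ =>
    isClosed_le (continuous_const.inner continuous_id) continuous_const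

lemma zero_mem_polarSet (C : Set E) : (0 : E) ∈ polarSet C := fun x _ => by simp

lemma convex_polarSet (C : Set E) : Convex ℝ (polarSet C) := by
  intro y hy y' hy' a b ha hb _ x hx
  rw [inner_add_right, inner_smul_right, inner_smul_right]
  nlinarith [hy x hx, hy' x hx]

lemma smul_mem_polarSet {C : Set E} {c : ℝ} (hc : 0 < c) {y : E} (hy : y ∈ polarSet C) :
    c • y ∈ polarSet C := fun x hx => by
  rw [inner_smul_right]
  nlinarith [hy x hx]

/-- Abstract form of the iteration, shifted so that every state is the outcome of a full step:
`U k i` is minus a subgradient of the `i`-th dual summand at `Y k i`, and `S k i` is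
normal to the dual cone at `Z k i`. -/
structure IsConsensusIteration (G : SimpleGraph N) [DecidableRel G.Adj] (σ ρ : ℝ)
    (Y Z S U : ℕ → N → E) (F : ℕ → N → N → E) : Prop where
  S_succ : ∀ k i, S (k + 1) i = S k i + σ • (Y (k + 1) i - Z (k + 1) i)
  F_succ : ∀ k i j, G.Adj i j → F (k + 1) i j = F k i j + ρ • (Y (k + 1) i - Y (k + 1) j)
  F_antisymm : ∀ k i j, F k i j = -F k j i
  F_nonadj : ∀ k i j, ¬ G.Adj i j → F k i j = 0
  U_succ : ∀ k i, U (k + 1) i = S (k + 1) i + σ • (Z (k + 1) i - Z k i)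
    + ∑ j ∈ G.neighborFinset i, F (k + 1) i j
    + ρ • ∑ j ∈ G.neighborFinset i, ((Y (k + 1) i - Y k i) + (Y (k + 1) j - Y k j))
  mono_U : ∀ k l i, ⟪Y k i - Y l i, U k i - U l i⟫ ≤ 0
  mono_S : ∀ k l i, 0 ≤ ⟪Z k i - Z l i, S k i - S l i⟫

/-- A stationary point, as seen by the monotonicity inequalities along the iteration. -/
structure IsConsensusStationary (G : SimpleGraph N) [DecidableRel G.Adj]
    (Y Z S U : ℕ → N → E) (ybar : E) (sbar : N → E) (Fbar : N → N → E) : Prop where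
  antisymm : ∀ i j, Fbar i j = -Fbar j i
  mono_U : ∀ k i,
    ⟪Y k i - ybar, U k i - (sbar i + ∑ j ∈ G.neighborFinset i, Fbar i j)⟫ ≤ 0
  mono_S : ∀ k i, 0 ≤ ⟪Z k i - ybar, S k i - sbar i⟫

variable {Y Z S U : ℕ → N → E} {F : ℕ → N → N → E}
  {ybar : E} {sbar : N → E} {Fbar : N → N → E}

lemma IsConsensusIteration.node_le (h : IsConsensusIteration G σ ρ Y Z S U F) (hσ : 0 < σ)
    (hs : IsConsensusStationary G Y Z S U ybar sbar Fbar) (k : ℕ) (i : N) :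
    (1 / (2 * σ) * ‖S (k + 1) i - sbar i‖ ^ 2 + σ / 2 * ‖Z (k + 1) i - ybar‖ ^ 2)
      + (1 / (2 * σ) * ‖S (k + 1) i - S k i‖ ^ 2 + σ / 2 * ‖Z (k + 1) i - Z k i‖ ^ 2)
      - (1 / (2 * σ) * ‖S k i - sbar i‖ ^ 2 + σ / 2 * ‖Z k i - ybar‖ ^ 2)
    ≤ ⟪Y (k + 1) i - ybar, S (k + 1) i - sbar i⟫
      + σ * ⟪Y (k + 1) i - ybar, Z (k + 1) i - Z k i⟫ := by
  have hY : Y (k + 1) i - ybar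
      = (Z (k + 1) i - ybar) + (1 / σ) • (S (k + 1) i - S k i) := by
    rw [h.S_succ k i, add_sub_cancel_left, smul_smul, one_div_mul_cancel hσ.ne', one_smul]
    abel
  rw [hY, inner_add_left, inner_add_left, inner_smul_left, inner_smul_left]
  have h1 := hs.mono_S (k + 1) i
  have h2 := h.mono_S (k + 1) k i
  rw [real_inner_comm] at h2
  have h3 := two_mul_inner_sub_sub (S (k + 1) i) (S k i) (sbar i)
  have h4 := two_mul_inner_sub_sub (Z (k + 1) i) (Z k i) ybar
  rw [real_inner_comm] at h4
  simp only [conj_trivial]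
  have e3 : 1 / σ * ⟪S (k + 1) i - S k i, S (k + 1) i - sbar i⟫ = 1 / (2 * σ) *
      (‖S (k + 1) i - sbar i‖ ^ 2 - ‖S k i - sbar i‖ ^ 2 + ‖S (k + 1) i - S k i‖ ^ 2) := by
    rw [← h3]; field_simp
  have e4 : σ * (1 / σ * ⟪S (k + 1) i - S k i, Z (k + 1) i - Z k i⟫)
      = ⟪S (k + 1) i - S k i, Z (k + 1) i - Z k i⟫ := by field_simp
  rw [mul_add, e3, e4]
  have e5 := congrArg (fun t => σ / 2 * t) h4
  nlinarith

lemma sum_inner_flow (a : N → E) (M : N → N → E) (hM : ∀ i j, M i j = -M j i) :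
    ∑ i, ⟪a i, ∑ j ∈ G.neighborFinset i, M i j⟫
      = ∑ i, ∑ j ∈ G.neighborFinset i, 1 / 2 * ⟪a i - a j, M i j⟫ := by
  have h1 : ∑ i, ⟪a i, ∑ j ∈ G.neighborFinset i, M i j⟫
      = ∑ i, ∑ j ∈ G.neighborFinset i, ⟪a i, M i j⟫ := by simp [inner_sum]
  have h2 : ∑ i, ∑ j ∈ G.neighborFinset i, ⟪a i, M i j⟫
      = ∑ i, ∑ j ∈ G.neighborFinset i, -⟪a j, M i j⟫ := by
    rw [G.sum_neighborFinset_comm]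
    refine Finset.sum_congr rfl fun i _ => Finset.sum_congr rfl fun j _ => ?_
    rw [hM j i, inner_neg_right]
  have h3 : ∑ i, ∑ j ∈ G.neighborFinset i, 1 / 2 * ⟪a i - a j, M i j⟫
      = 1 / 2 * (∑ i, ∑ j ∈ G.neighborFinset i, ⟪a i, M i j⟫
        + ∑ i, ∑ j ∈ G.neighborFinset i, -⟪a j, M i j⟫) := by
    simp only [← Finset.sum_add_distrib, Finset.mul_sum, inner_sub_left, ← sub_eq_add_neg]
  rw [h3, ← h2, h1]
  ring

lemma sum_inner_signless (a c : N → E) :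
    ∑ i, ⟪a i, ∑ j ∈ G.neighborFinset i, (c i + c j)⟫
      = ∑ i, ∑ j ∈ G.neighborFinset i, 1 / 2 * ⟪a i + a j, c i + c j⟫ := by
  have h1 : ∑ i, ⟪a i, ∑ j ∈ G.neighborFinset i, (c i + c j)⟫
      = ∑ i, ∑ j ∈ G.neighborFinset i, ⟪a i, c i + c j⟫ := by simp [inner_sum]
  have h2 : ∑ i, ∑ j ∈ G.neighborFinset i, ⟪a i, c i + c j⟫
      = ∑ i, ∑ j ∈ G.neighborFinset i, ⟪a j, c i + c j⟫ := by
    rw [G.sum_neighborFinset_comm]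
    simp only [add_comm]
  have h3 : ∑ i, ∑ j ∈ G.neighborFinset i, 1 / 2 * ⟪a i + a j, c i + c j⟫
      = 1 / 2 * (∑ i, ∑ j ∈ G.neighborFinset i, ⟪a i, c i + c j⟫
        + ∑ i, ∑ j ∈ G.neighborFinset i, ⟪a j, c i + c j⟫) := by
    simp only [← Finset.sum_add_distrib, Finset.mul_sum, inner_add_left]
  rw [h3, ← h2, h1]
  ring

lemma IsConsensusIteration.energy_succ_le (h : IsConsensusIteration G σ ρ Y Z S U F)
    (hσ : 0 < σ) (hρ : 0 < ρ) (hs : IsConsensusStationary G Y Z S U ybar sbar Fbar) (k : ℕ) :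
    consensusEnergy G σ ρ (fun i => Y (k + 1) i - ybar) (fun i => Z (k + 1) i - ybar)
        (fun i => S (k + 1) i - sbar i) (fun i j => F (k + 1) i j - Fbar i j)
      + consensusEnergy G σ ρ (fun i => Y (k + 1) i - Y k i) (fun i => Z (k + 1) i - Z k i)
        (fun i => S (k + 1) i - S k i) (fun i j => F (k + 1) i j - F k i j)
    ≤ consensusEnergy G σ ρ (fun i => Y k i - ybar) (fun i => Z k i - ybar)
        (fun i => S k i - sbar i) (fun i j => F k i j - Fbar i j) := by
  have hU := Finset.sum_nonpos fun i (_ : i ∈ Finset.univ) => hs.mono_U (k + 1) i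
  have hsplit : ∀ i, U (k + 1) i - (sbar i + ∑ j ∈ G.neighborFinset i, Fbar i j)
      = (S (k + 1) i - sbar i) + σ • (Z (k + 1) i - Z k i)
        + ∑ j ∈ G.neighborFinset i, (F (k + 1) i j - Fbar i j)
        + ρ • ∑ j ∈ G.neighborFinset i, ((Y (k + 1) i - Y k i) + (Y (k + 1) j - Y k j)) := by
    intro i
    rw [h.U_succ, Finset.sum_sub_distrib]
    abel
  have hinner : ∀ i, ⟪Y (k + 1) i - ybar,
        U (k + 1) i - (sbar i + ∑ j ∈ G.neighborFinset i, Fbar i j)⟫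
      = (⟪Y (k + 1) i - ybar, S (k + 1) i - sbar i⟫
          + σ * ⟪Y (k + 1) i - ybar, Z (k + 1) i - Z k i⟫)
        + ⟪Y (k + 1) i - ybar, ∑ j ∈ G.neighborFinset i, (F (k + 1) i j - Fbar i j)⟫
        + ρ * ⟪Y (k + 1) i - ybar,
          ∑ j ∈ G.neighborFinset i, ((Y (k + 1) i - Y k i) + (Y (k + 1) j - Y k j))⟫ := by
    intro i
    rw [hsplit, inner_add_right, inner_add_right, inner_add_right, inner_smul_right,
      inner_smul_right]
  rw [Finset.sum_congr rfl fun i _ => hinner i, Finset.sum_add_distrib,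
    Finset.sum_add_distrib] at hU
  have hnode := Finset.sum_le_sum fun i (_ : i ∈ Finset.univ) => h.node_le hσ hs k i
  have hflow := sum_inner_flow (G := G) (fun i => Y (k + 1) i - ybar)
    (fun i j => F (k + 1) i j - Fbar i j) fun i j => by
      rw [h.F_antisymm, hs.antisymm i j]; abel
  have hsign := sum_inner_signless (G := G) (fun i => Y (k + 1) i - ybar)
    (fun i => Y (k + 1) i - Y k i)
  have hflow' : ∑ i, ∑ j ∈ G.neighborFinset i,
        1 / 2 * ⟪(Y (k + 1) i - ybar) - (Y (k + 1) j - ybar), F (k + 1) i j - Fbar i j⟫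
      = ∑ i, ∑ j ∈ G.neighborFinset i, (1 / (4 * ρ) * ‖F (k + 1) i j - Fbar i j‖ ^ 2
        + 1 / (4 * ρ) * ‖F (k + 1) i j - F k i j‖ ^ 2
        - 1 / (4 * ρ) * ‖F k i j - Fbar i j‖ ^ 2) := by
    refine Finset.sum_congr rfl fun i _ => Finset.sum_congr rfl fun j hj => ?_
    have e : (Y (k + 1) i - ybar) - (Y (k + 1) j - ybar)
        = (1 / ρ) • (F (k + 1) i j - F k i j) := by
      rw [h.F_succ k i j (by simpa using hj), add_sub_cancel_left, smul_smul,
        one_div_mul_cancel hρ.ne', one_smul]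
      abel
    have e2 := two_mul_inner_sub_sub (F (k + 1) i j) (F k i j) (Fbar i j)
    rw [e, inner_smul_left, conj_trivial]
    have e3 : ⟪F (k + 1) i j - F k i j, F (k + 1) i j - Fbar i j⟫ = 1 / 2 *
      (‖F (k + 1) i j - Fbar i j‖ ^ 2 - ‖F k i j - Fbar i j‖ ^ 2
        + ‖F (k + 1) i j - F k i j‖ ^ 2) := by linarith
    rw [e3]
    field_simp
    ring
  have hsign' : ρ * ∑ i, ∑ j ∈ G.neighborFinset i, 1 / 2 *
        ⟪(Y (k + 1) i - ybar) + (Y (k + 1) j - ybar),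
          (Y (k + 1) i - Y k i) + (Y (k + 1) j - Y k j)⟫
      = ∑ i, ∑ j ∈ G.neighborFinset i, (ρ / 4 * ‖(Y (k + 1) i - ybar)
        + (Y (k + 1) j - ybar)‖ ^ 2 + ρ / 4 * ‖(Y (k + 1) i - Y k i) + (Y (k + 1) j - Y k j)‖ ^ 2
        - ρ / 4 * ‖(Y k i - ybar) + (Y k j - ybar)‖ ^ 2) := by
    rw [Finset.mul_sum]
    refine Finset.sum_congr rfl fun i _ => ?_
    rw [Finset.mul_sum]
    refine Finset.sum_congr rfl fun j _ => ?_
    have e := two_mul_inner_sub_sub ((Y (k + 1) i - ybar) + (Y (k + 1) j - ybar))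
      ((Y k i - ybar) + (Y k j - ybar)) 0
    have e2 : ((Y (k + 1) i - ybar) + (Y (k + 1) j - ybar))
      - ((Y k i - ybar) + (Y k j - ybar))
      = (Y (k + 1) i - Y k i) + (Y (k + 1) j - Y k j) := by abel
    rw [e2, sub_zero, sub_zero, real_inner_comm] at e
    linear_combination ρ / 4 * e
  rw [← Finset.mul_sum, hsign, hflow, hflow', hsign'] at hU
  unfold consensusEnergy
  simp only [Finset.sum_add_distrib, Finset.sum_sub_distrib] at hU hnode ⊢
  linarith

/-- Convergence of the abstract iteration. -/
theorem IsConsensusIteration.exists_tendsto [FiniteDimensional ℝ E] (hG : G.Connected)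
    (h : IsConsensusIteration G σ ρ Y Z S U F) (hσ : 0 < σ) (hρ : 0 < ρ)
    (hs : IsConsensusStationary G Y Z S U ybar sbar Fbar) :
    ∃ (ystar : E) (sstar ustar : N → E), (∀ i, Tendsto (fun k => Y k i) atTop (𝓝 ystar)) ∧
      (∀ i, Tendsto (fun k => Z k i) atTop (𝓝 ystar)) ∧
      (∀ i, Tendsto (fun k => S k i) atTop (𝓝 (sstar i))) ∧
      (∀ i, Tendsto (fun k => U k i) atTop (𝓝 (ustar i))) ∧
      ∑ i, ustar i = ∑ i, sstar i := by
  classical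
  let V : E → (N → E) → (N → N → E) → ℕ → ℝ := fun y s f k =>
    consensusEnergy G σ ρ (fun i => Y k i - y) (fun i => Z k i - y)
      (fun i => S k i - s i) (fun i j => F k i j - f i j)
  let D : ℕ → ℝ := fun k =>
    consensusEnergy G σ ρ (fun i => Y (k + 1) i - Y k i) (fun i => Z (k + 1) i - Z k i)
      (fun i => S (k + 1) i - S k i) (fun i j => F (k + 1) i j - F k i j)
  have hstep : ∀ {y s f}, IsConsensusStationary G Y Z S U y s f →
      ∀ k, V y s f (k + 1) + D k ≤ V y s f k := fun hs' k => h.energy_succ_le hσ hρ hs' k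
  have hV0 : ∀ y s f k, 0 ≤ V y s f k := fun y s f k => consensusEnergy_nonneg hσ hρ _ _ _ _
  have hD0 : ∀ k, 0 ≤ D k := fun k => consensusEnergy_nonneg hσ hρ _ _ _ _
  have hanti : ∀ {y s f}, IsConsensusStationary G Y Z S U y s f → Antitone (V y s f) :=
    fun hs' => antitone_nat_of_succ_le fun k => by linarith [hstep hs' k, hD0 k]
  have hDlim : Tendsto D atTop (𝓝 0) := by
    have hlim := tendsto_atTop_ciInf (hanti hs) ⟨0, by rintro _ ⟨k, rfl⟩; exact hV0 _ _ _ k⟩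
    have hdiff := hlim.sub (hlim.comp (tendsto_add_atTop_nat 1))
    rw [sub_self] at hdiff
    exact squeeze_zero hD0 (fun k => by
      simp only [Function.comp]; linarith [hstep hs k]) hdiff
  have hdZ : ∀ i, Tendsto (fun k => Z (k + 1) i - Z k i) atTop (𝓝 0) := fun i =>
    tendsto_zero_of_sq_norm_le
      (fun k => sq_norm_z_le_consensusEnergy (G := G) hσ hρ _
        (fun i => Z (k + 1) i - Z k i) _ _ i) hDlim
  have hYZ : ∀ i, Tendsto (fun k => Y k i - Z k i) atTop (𝓝 0) := fun i => by
    rw [← tendsto_add_atTop_iff_nat 1]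
    have h1 : Tendsto (fun k => S (k + 1) i - S k i) atTop (𝓝 0) :=
      tendsto_zero_of_sq_norm_le
        (fun k => sq_norm_s_le_consensusEnergy (G := G) hσ hρ _ _
          (fun i => S (k + 1) i - S k i) _ i) hDlim
    have h2 := h1.const_smul (1 / σ)
    simpa only [h.S_succ, add_sub_cancel_left, smul_smul, one_div_mul_cancel hσ.ne', one_smul,
      smul_zero] using h2
  have hYY : ∀ i j, Tendsto (fun k => Y k i - Y k j) atTop (𝓝 0) :=
    hG.tendsto_sub_zero fun i j hij => by
      rw [← tendsto_add_atTop_iff_nat 1]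
      have h1 : Tendsto (fun k => F (k + 1) i j - F k i j) atTop (𝓝 0) :=
        tendsto_zero_of_sq_norm_le
          (fun k => sq_norm_flow_le_consensusEnergy (G := G) hσ hρ _ _ _
            (fun i j => F (k + 1) i j - F k i j) hij) hDlim
      have h2 := h1.const_smul (1 / ρ)
      simpa only [h.F_succ _ i j hij, add_sub_cancel_left, smul_smul,
        one_div_mul_cancel hρ.ne', one_smul, smul_zero] using h2
  have hdY : ∀ i, Tendsto (fun k => Y (k + 1) i - Y k i) atTop (𝓝 0) := fun i => by
    have h1 := (((hYZ i).comp (tendsto_add_atTop_nat 1)).add (hdZ i)).sub (hYZ i)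
    simp only [add_zero, sub_zero] at h1
    refine h1.congr fun k => ?_
    simp only [Function.comp]
    abel
  have hUres : ∀ i, Tendsto (fun k => U k i - S k i - ∑ j ∈ G.neighborFinset i, F k i j)
      atTop (𝓝 0) := fun i => by
    rw [← tendsto_add_atTop_iff_nat 1]
    have h1 := ((hdZ i).const_smul σ).add ((tendsto_finsetSum (G.neighborFinset i)
      fun j _ => (hdY i).add (hdY j)).const_smul ρ)
    simp only [add_zero, smul_zero, Finset.sum_const_zero] at h1
    refine h1.congr fun k => ?_
    rw [h.U_succ]
    abel
  -- a convergent subsequence of the bounded states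
  have hVle : ∀ k, V ybar sbar Fbar k ≤ V ybar sbar Fbar 0 := fun k => hanti hs (Nat.zero_le k)
  have hbZ : ∀ i, ∃ C, ∀ k, ‖Z k i‖ ≤ C := fun i =>
    exists_norm_le_of_sq_norm_sub_le (abar := ybar) (c := 2 / σ * V ybar sbar Fbar 0) fun k =>
      (sq_norm_z_le_consensusEnergy (G := G) hσ hρ _ (fun i => Z k i - ybar) _ _ i).trans
        (mul_le_mul_of_nonneg_left (hVle k) (by positivity))
  have hbS : ∀ i, ∃ C, ∀ k, ‖S k i‖ ≤ C := fun i =>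
    exists_norm_le_of_sq_norm_sub_le (abar := sbar i) (c := 2 * σ * V ybar sbar Fbar 0) fun k =>
      (sq_norm_s_le_consensusEnergy (G := G) hσ hρ _ _ (fun i => S k i - sbar i) _ i).trans
        (mul_le_mul_of_nonneg_left (hVle k) (by positivity))
  have hbF : ∀ i j, ∃ C, ∀ k, ‖F k i j‖ ≤ C := fun i j => by
    by_cases hij : G.Adj i j
    · exact exists_norm_le_of_sq_norm_sub_le (abar := Fbar i j)
        (c := 4 * ρ * V ybar sbar Fbar 0) fun k =>
        (sq_norm_flow_le_consensusEnergy (G := G) hσ hρ _ _ _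
          (fun i j => F k i j - Fbar i j) hij).trans
          (mul_le_mul_of_nonneg_left (hVle k) (by positivity))
    · exact ⟨0, fun k => by rw [h.F_nonadj k i j hij, norm_zero]⟩
  choose CZ hCZ using hbZ
  choose CS hCS using hbS
  choose CF hCF using hbF
  have hcompact : IsCompact ((Set.univ.pi fun i => Metric.closedBall (0 : E) (CZ i)) ×ˢ
      (Set.univ.pi fun i => Metric.closedBall (0 : E) (CS i)) ×ˢ
      (Set.univ.pi fun i => Set.univ.pi fun j => Metric.closedBall (0 : E) (CF i j))) :=
    (isCompact_univ_pi fun i => isCompact_closedBall _ _).prod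
      ((isCompact_univ_pi fun i => isCompact_closedBall _ _).prod
        (isCompact_univ_pi fun i => isCompact_univ_pi fun j => isCompact_closedBall _ _))
  obtain ⟨⟨zs, ss, fs⟩, -, φ, hφ, hlim⟩ := hcompact.tendsto_subseq
    (x := fun k => (Z k, S k, F k)) fun k => by
      simp only [Set.mem_prod, Set.mem_pi, Set.mem_univ, forall_const, mem_closedBall_zero_iff]
      exact ⟨fun i => hCZ i k, fun i => hCS i k, fun i j => hCF i j k⟩
  obtain ⟨hlimZ, hlimSF⟩ := (Prod.tendsto_iff _ _).1 hlim
  obtain ⟨hlimS, hlimF⟩ := (Prod.tendsto_iff _ _).1 hlimSF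
  simp only [tendsto_pi_nhds, Function.comp] at hlimZ hlimS hlimF
  have hφt := hφ.tendsto_atTop
  have hlimY : ∀ i, Tendsto (fun k => Y (φ k) i) atTop (𝓝 (zs i)) := fun i => by
    simpa using ((hYZ i).comp hφt).add (hlimZ i)
  have hlimU : ∀ i, Tendsto (fun k => U (φ k) i) atTop
      (𝓝 (ss i + ∑ j ∈ G.neighborFinset i, fs i j)) := fun i => by
    have h1 := (((hUres i).comp hφt).add (hlimS i)).add
      (tendsto_finsetSum (G.neighborFinset i) fun j _ => hlimF i j)
    simp only [zero_add] at h1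
    refine h1.congr fun k => ?_
    simp only [Function.comp]
    abel
  obtain ⟨o⟩ := hG.nonempty
  have hzs : ∀ i, zs i = zs o := fun i =>
    sub_eq_zero.1 (tendsto_nhds_unique ((hlimY i).sub (hlimY o)) ((hYY i o).comp hφt))
  have hfs : ∀ i j, fs i j = -fs j i := fun i j =>
    tendsto_nhds_unique (hlimF i j)
      ((hlimF j i).neg.congr fun k => (h.F_antisymm (φ k) i j).symm)
  have hstar : IsConsensusStationary G Y Z S U (zs o) ss fs :=
    { antisymm := hfs
      mono_U := fun k i => le_of_tendsto
        ((tendsto_const_nhds.sub (hzs i ▸ hlimY i)).inner (tendsto_const_nhds.sub (hlimU i)))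
        (Eventually.of_forall fun l => h.mono_U k (φ l) i)
      mono_S := fun k i => ge_of_tendsto
        ((tendsto_const_nhds.sub (hzs i ▸ hlimZ i)).inner (tendsto_const_nhds.sub (hlimS i)))
        (Eventually.of_forall fun l => h.mono_S k (φ l) i) }
  have hVlim : Tendsto (V (zs o) ss fs) atTop (𝓝 0) := by
    refine (tendsto_iff_tendsto_subseq_of_antitone (hanti hstar) hφt).2 ?_
    exact tendsto_consensusEnergy_zero
      (fun i => tendsto_sub_nhds_zero_iff.2 (hzs i ▸ hlimY i))
      (fun i => tendsto_sub_nhds_zero_iff.2 (hzs i ▸ hlimZ i))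
      (fun i => tendsto_sub_nhds_zero_iff.2 (hlimS i))
      (fun i j => tendsto_sub_nhds_zero_iff.2 (hlimF i j))
  have hZ : ∀ i, Tendsto (fun k => Z k i) atTop (𝓝 (zs o)) := fun i =>
    tendsto_sub_nhds_zero_iff.1 (tendsto_zero_of_sq_norm_le
      (fun k => sq_norm_z_le_consensusEnergy (G := G) hσ hρ _ (fun i => Z k i - zs o) _ _ i)
      hVlim)
  have hS : ∀ i, Tendsto (fun k => S k i) atTop (𝓝 (ss i)) := fun i =>
    tendsto_sub_nhds_zero_iff.1 (tendsto_zero_of_sq_norm_le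
      (fun k => sq_norm_s_le_consensusEnergy (G := G) hσ hρ _ _ (fun i => S k i - ss i) _ i)
      hVlim)
  have hF : ∀ i j, G.Adj i j → Tendsto (fun k => F k i j) atTop (𝓝 (fs i j)) := fun i j hij =>
    tendsto_sub_nhds_zero_iff.1 (tendsto_zero_of_sq_norm_le
      (fun k => sq_norm_flow_le_consensusEnergy (G := G) hσ hρ _ _ _
        (fun i j => F k i j - fs i j) hij) hVlim)
  refine ⟨zs o, ss, fun i => ss i + ∑ j ∈ G.neighborFinset i, fs i j, fun i => ?_, hZ, hS,
    fun i => ?_, ?_⟩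
  · simpa using (hYZ i).add (hZ i)
  · have h1 := ((hUres i).add (hS i)).add
      (tendsto_finsetSum (G.neighborFinset i) fun j hj => hF i j (by simpa using hj))
    simp only [zero_add] at h1
    refine h1.congr fun k => ?_
    abel
  · have h1 : ∑ i, ∑ j ∈ G.neighborFinset i, fs i j
        = -∑ i, ∑ j ∈ G.neighborFinset i, fs i j := by
      conv_lhs => rw [G.sum_neighborFinset_comm]
      simp only [← Finset.sum_neg_distrib]
      exact Finset.sum_congr rfl fun i _ => Finset.sum_congr rfl fun j _ => hfs j i
    have h2 : ∑ i, ∑ j ∈ G.neighborFinset i, fs i j = 0 := by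
      have h3 : (2 : ℝ) • ∑ i, ∑ j ∈ G.neighborFinset i, fs i j = 0 := by
        rw [two_smul]
        exact eq_neg_iff_add_eq_zero.1 h1
      exact (smul_eq_zero.1 h3).resolve_left two_ne_zero
    rw [Finset.sum_add_distrib, h2, add_zero]

variable {X : Type*} [NormedAddCommGroup X] [InnerProductSpace ℝ X]

lemma nonneg_of_forall_mul_add_sq_mul_nonneg {α β : ℝ}
    (h : ∀ t : ℝ, 0 < t → t ≤ 1 → 0 ≤ t * α + t ^ 2 * β) : 0 ≤ α := by
  have hlim : Tendsto (fun t : ℝ => α + t * β) (𝓝[>] 0) (𝓝 α) := by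
    have : Tendsto (fun t : ℝ => α + t * β) (𝓝 0) (𝓝 (α + 0 * β)) :=
      tendsto_const_nhds.add (tendsto_id.mul_const β)
    rw [zero_mul, add_zero] at this
    exact this.mono_left nhdsWithin_le_nhds
  refine ge_of_tendsto hlim ?_
  filter_upwards [Ioc_mem_nhdsGT (zero_lt_one' ℝ)] with t ht
  have := h t ht.1 ht.2
  nlinarith [ht.1]

/-- First-order optimality condition for a convex function plus a quadratic. -/
lemma subgradient_of_forall_add_sq_le {f : X → EReal} (hconv : EConvexFn f) (hf : EProper f)
    (A : X →ₗ[ℝ] E) (r : E) {τ : ℝ} (hτ : 0 < τ) {x : X}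
    (hmin : ∀ v, f x + ((1 / (2 * τ) * ‖A x + r‖ ^ 2 : ℝ) : EReal)
      ≤ f v + ((1 / (2 * τ) * ‖A v + r‖ ^ 2 : ℝ) : EReal)) :
    f x ≠ ⊤ ∧ ∀ v, f x ≤ f v + ((⟪(1 / τ) • (A x + r), A v - A x⟫ : ℝ) : EReal) := by
  have hx : f x ≠ ⊤ := by
    intro hx
    obtain ⟨v, hv⟩ := hf.2
    have h := hmin v
    rw [hx, EReal.top_add_coe, top_le_iff] at h
    exact (EReal.add_lt_top hv (EReal.coe_ne_top _)).ne h
  refine ⟨hx, fun v => ?_⟩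
  by_cases hv : f v = ⊤
  · rw [hv, EReal.top_add_coe]; exact le_top
  lift f x to ℝ using ⟨hx, hf.1 x⟩ with a ha
  lift f v to ℝ using ⟨hv, hf.1 v⟩ with c hc
  rw [← EReal.coe_add, EReal.coe_le_coe_iff]
  have key : 0 ≤ (c - a) + 1 / τ * ⟪A x + r, A v - A x⟫ := by
    refine nonneg_of_forall_mul_add_sq_mul_nonneg (β := 1 / (2 * τ) * ‖A v - A x‖ ^ 2)
      fun t ht0 ht1 => ?_
    have h1 := hmin ((1 - t) • x + t • v)
    have h2 := hconv x v (1 - t) t (by linarith) ht0.le (by ring)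
    rw [← ha, ← hc, ← EReal.coe_mul, ← EReal.coe_mul, ← EReal.coe_add] at h2
    have h3 := h1.trans (add_le_add_left h2 _)
    rw [← EReal.coe_add, ← EReal.coe_add, EReal.coe_le_coe_iff] at h3
    have h4 : A ((1 - t) • x + t • v) + r = (A x + r) + t • (A v - A x) := by
      rw [map_add, map_smul, map_smul]; module
    rw [h4, norm_add_sq_real (A x + r) (t • (A v - A x)), inner_smul_right, norm_smul, Real.norm_eq_abs, mul_pow,
      sq_abs] at h3
    have h5 : t * (c - a + 1 / τ * ⟪A x + r, A v - A x⟫) = t * (c - a)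
      + 1 / (2 * τ) * (2 * (t * ⟪A x + r, A v - A x⟫)) := by field_simp
    rw [h5]
    nlinarith
  rw [inner_smul_left, conj_trivial]
  linarith

lemma inner_sub_nonpos_of_subgradient {f : X → EReal} {A : X →ₗ[ℝ] E} {x x' : X} {y y' : E}
    (hx : f x ≠ ⊥ ∧ f x ≠ ⊤) (hx' : f x' ≠ ⊥ ∧ f x' ≠ ⊤)
    (h : f x ≤ f x' + ((⟪y, A x' - A x⟫ : ℝ) : EReal))
    (h' : f x' ≤ f x + ((⟪y', A x - A x'⟫ : ℝ) : EReal)) : ⟪y - y', A x - A x'⟫ ≤ 0 := by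
  lift f x to ℝ using ⟨hx.2, hx.1⟩ with a
  lift f x' to ℝ using ⟨hx'.2, hx'.1⟩ with a'
  rw [← EReal.coe_add, EReal.coe_le_coe_iff] at h h'
  rw [← neg_sub (A x) (A x'), inner_neg_right] at h
  rw [inner_sub_left]
  linarith

/-- The subgradient inequality passes to limits of the points and multipliers. -/
lemma subgradient_of_tendsto [FiniteDimensional ℝ X] {f : X → EReal}
    (hlsc : LowerSemicontinuous f) (hf : EProper f) {A : X →ₗ[ℝ] E}
    {xs : ℕ → X} {ys : ℕ → E} {xl : X} {yl : E} (hx : Tendsto xs atTop (𝓝 xl))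
    (hy : Tendsto ys atTop (𝓝 yl))
    (h : ∀ k v, f (xs k) ≤ f v + ((⟪ys k, A v - A (xs k)⟫ : ℝ) : EReal)) (v : X) :
    f xl ≤ f v + ((⟪yl, A v - A xl⟫ : ℝ) : EReal) := by
  have hA : Continuous A := A.continuous_of_finiteDimensional
  by_cases hv : f v = ⊤
  · rw [hv, EReal.top_add_coe]; exact le_top
  replace h := fun k => h k v
  lift f v to ℝ using ⟨hv, hf.1 v⟩ with c
  simp only [← EReal.coe_add] at h ⊢
  by_contra! hlt
  obtain ⟨a, ha1, ha2⟩ := EReal.lt_iff_exists_real_btwn.1 hlt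
  have h1 : ∀ᶠ k in atTop, (a : EReal) < f (xs k) := hx.eventually (hlsc xl a ha2)
  have h2 : Tendsto (fun k => c + ⟪ys k, A v - A (xs k)⟫) atTop (𝓝 (c + ⟪yl, A v - A xl⟫)) :=
    tendsto_const_nhds.add (hy.inner (tendsto_const_nhds.sub ((hA.tendsto xl).comp hx)))
  refine absurd (EReal.coe_lt_coe_iff.1 ha1) (not_lt.2 (ge_of_tendsto h2 ?_))
  filter_upwards [h1] with k hk
  exact (EReal.coe_lt_coe_iff.1 (hk.trans_le (h k))).le

/-- The dual summand `y ↦ f*(-Aᵀ y) + ⟪y, b⟫` has subgradient `-u` at `yl`, whenever `(yl, u)` is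
a limit of pairs `(ys k, A (xs k) - b)` with `-Aᵀ (ys k)` a subgradient of `f` at `xs k`. -/
lemma econj_adjoint_add_le_of_tendsto [FiniteDimensional ℝ X] [FiniteDimensional ℝ E]
    {f : X → EReal} (hf : EProper f) {A : X →ₗ[ℝ] E} {b : E}
    {xs : ℕ → X} {ys : ℕ → E} {u yl : E}
    (hu : Tendsto (fun k => A (xs k) - b) atTop (𝓝 u)) (hy : Tendsto ys atTop (𝓝 yl))
    (hfin : ∀ k, f (xs k) ≠ ⊤)
    (h : ∀ k v, f (xs k) ≤ f v + ((⟪ys k, A v - A (xs k)⟫ : ℝ) : EReal)) (y' : E) :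
    econj f (-(LinearMap.adjoint A yl)) + ((⟪yl, b⟫ : ℝ) : EReal)
      ≤ econj f (-(LinearMap.adjoint A y')) + ((⟪y', b⟫ : ℝ) : EReal)
        + ((⟪y' - yl, u⟫ : ℝ) : EReal) := by
  have hle : ∀ x, ((⟪-(LinearMap.adjoint A y'), x⟫ : ℝ) : EReal) - f x
      ≤ econj f (-(LinearMap.adjoint A y')) := fun x =>
    le_iSup (fun x => ((⟪-(LinearMap.adjoint A y'), x⟫ : ℝ) : EReal) - f x) x
  generalize econj f (-(LinearMap.adjoint A y')) = C at hle ⊢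
  by_cases hC : C = ⊤
  · rw [hC, EReal.top_add_coe, EReal.top_add_coe]; exact le_top
  have hfr : ∀ k, ∃ a : ℝ, f (xs k) = a := fun k =>
    ⟨(f (xs k)).toReal, (EReal.coe_toReal (hfin k) (hf.1 _)).symm⟩
  choose a ha using hfr
  have hCbot : C ≠ ⊥ := by
    rintro rfl
    have := hle (xs 0)
    rw [ha, ← EReal.coe_sub, le_bot_iff] at this
    exact EReal.coe_ne_bot _ this
  lift C to ℝ using ⟨hC, hCbot⟩ with c
  have hsup : econj f (-(LinearMap.adjoint A yl)) ≤ ((c + ⟪y' - yl, u + b⟫ : ℝ) : EReal) := by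
    refine iSup_le fun v => ?_
    by_cases hv : f v = ⊤
    · rw [hv, EReal.sub_top]; exact bot_le
    replace h := fun k => h k v
    lift f v to ℝ using ⟨hv, hf.1 v⟩ with g
    rw [← EReal.coe_sub, EReal.coe_le_coe_iff]
    rw [inner_neg_left, LinearMap.adjoint_inner_left]
    have h1 : Tendsto (fun k => -⟪ys k, A v⟫ - g) atTop (𝓝 (-⟪yl, A v⟫ - g)) :=
      ((hy.inner tendsto_const_nhds).neg).sub_const g
    have h2 : Tendsto (fun k => c + ⟪y' - ys k, (A (xs k) - b) + b⟫) atTop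
        (𝓝 (c + ⟪y' - yl, u + b⟫)) :=
      tendsto_const_nhds.add ((tendsto_const_nhds.sub hy).inner (hu.add_const b))
    refine le_of_tendsto_of_tendsto' h1 h2 fun k => ?_
    have h3 := h k
    have h4 := hle (xs k)
    rw [ha, ← EReal.coe_add, EReal.coe_le_coe_iff, inner_sub_right] at h3
    rw [ha, ← EReal.coe_sub, EReal.coe_le_coe_iff, inner_neg_left,
      LinearMap.adjoint_inner_left] at h4
    rw [sub_add_cancel, inner_sub_left]
    linarith
  refine (add_le_add_left hsup _).trans ?_
  rw [← EReal.coe_add, ← EReal.coe_add, ← EReal.coe_add, EReal.coe_le_coe_iff]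
  simp only [inner_sub_left, inner_add_right]
  linarith

lemma EReal.coe_finset_sum {ι : Type*} (s : Finset ι) (g : ι → ℝ) :
    ((∑ i ∈ s, g i : ℝ) : EReal) = ∑ i ∈ s, (g i : EReal) := by
  classical
  induction s using Finset.induction_on with
  | empty => simp
  | insert i s hi ih => rw [Finset.sum_insert hi, Finset.sum_insert hi, EReal.coe_add, ih]

lemma EReal.ne_top_of_sum_ne_top {ι : Type*} {s : Finset ι} {g : ι → EReal}
    (hbot : ∀ i ∈ s, g i ≠ ⊥) (hsum : ∑ i ∈ s, g i ≠ ⊤) : ∀ i ∈ s, g i ≠ ⊤ := by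
  classical
  intro i hi htop
  refine hsum ?_
  rw [← Finset.add_sum_erase s g hi, htop]
  refine EReal.top_add_of_ne_bot ?_
  have : ∀ t : Finset ι, (∀ j ∈ t, g j ≠ ⊥) → ∑ j ∈ t, g j ≠ ⊥ := by
    intro t
    induction t using Finset.induction_on with
    | empty => simp
    | insert j t hj ih =>
      intro ht
      rw [Finset.sum_insert hj]
      simp only [ne_eq, EReal.add_eq_bot_iff, not_or]
      exact ⟨ht j (by simp), ih fun l hl => ht l (by simp [hl])⟩
  exact this _ fun j hj => hbot j (Finset.mem_of_mem_erase hj)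

/-- A primal-dual pair with zero gap satisfies the optimality conditions. -/
lemma subgradient_of_zero_gap {n : N → Type*} [∀ i, NormedAddCommGroup (n i)]
    [∀ i, InnerProductSpace ℝ (n i)] [∀ i, FiniteDimensional ℝ (n i)] [FiniteDimensional ℝ E]
    {f : ∀ i, n i → EReal} (hproper : ∀ i, EProper (f i)) {A : ∀ i, n i →ₗ[ℝ] E} {b : N → E}
    {xbar : ∀ i, n i} {ybar : E} (hle : ⟪ybar, ∑ i, (A i (xbar i) - b i)⟫ ≤ 0)
    (hgap : (∑ i, f i (xbar i)) = -(∑ i, (econj (f i) (-(LinearMap.adjoint (A i) ybar))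
      + ((⟪ybar, b i⟫ : ℝ) : EReal))))
    (htop : (∑ i, f i (xbar i)) ≠ ⊤) (hbot : (∑ i, f i (xbar i)) ≠ ⊥) :
    (∀ i, f i (xbar i) ≠ ⊤) ∧ ⟪ybar, ∑ i, (A i (xbar i) - b i)⟫ = 0 ∧
      ∀ i v, f i (xbar i) ≤ f i v + ((⟪ybar, A i v - A i (xbar i)⟫ : ℝ) : EReal) := by
  have hF := EReal.ne_top_of_sum_ne_top (fun i _ => (hproper i).1 (xbar i)) htop
  have hFr : ∀ i, ∃ a : ℝ, f i (xbar i) = a := fun i => ⟨(f i (xbar i)).toReal,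
    (EReal.coe_toReal (hF i (Finset.mem_univ i)) ((hproper i).1 _)).symm⟩
  choose a ha using hFr
  have hconj : ∀ i v, ((⟪-(LinearMap.adjoint (A i) ybar), v⟫ : ℝ) : EReal) - f i v
      ≤ econj (f i) (-(LinearMap.adjoint (A i) ybar)) := fun i v =>
    le_iSup (fun x => ((⟪-(LinearMap.adjoint (A i) ybar), x⟫ : ℝ) : EReal) - f i x) v
  have hCbot : ∀ i, econj (f i) (-(LinearMap.adjoint (A i) ybar)) ≠ ⊥ := fun i hi => by
    have := hconj i (xbar i)
    rw [hi, ha, ← EReal.coe_sub, le_bot_iff] at this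
    exact EReal.coe_ne_bot _ this
  have hCtop : ∀ i, econj (f i) (-(LinearMap.adjoint (A i) ybar)) ≠ ⊤ := fun i hi => by
    refine EReal.ne_top_of_sum_ne_top (s := Finset.univ)
      (g := fun i => econj (f i) (-(LinearMap.adjoint (A i) ybar)) + ((⟪ybar, b i⟫ : ℝ) : EReal))
      (fun j _ => ?_) ?_ i (Finset.mem_univ i) ?_
    · simp only [ne_eq, EReal.add_eq_bot_iff, not_or]
      exact ⟨hCbot j, EReal.coe_ne_bot _⟩
    · intro h
      rw [h, EReal.neg_top] at hgap
      exact hbot hgap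
    · simp only [hi, EReal.top_add_coe]
  have hCr : ∀ i, ∃ c : ℝ, econj (f i) (-(LinearMap.adjoint (A i) ybar)) = c := fun i =>
    ⟨_, (EReal.coe_toReal (hCtop i) (hCbot i)).symm⟩
  choose c hc using hCr
  simp only [ha, hc, ← EReal.coe_add, ← EReal.coe_finset_sum, ← EReal.coe_neg,
    EReal.coe_eq_coe_iff] at hgap
  have hyoung : ∀ i, 0 ≤ c i + ⟪ybar, b i⟫ + a i + ⟪ybar, A i (xbar i) - b i⟫ := fun i => by
    have := hconj i (xbar i)
    rw [ha, hc, ← EReal.coe_sub, EReal.coe_le_coe_iff, inner_neg_left,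
      LinearMap.adjoint_inner_left] at this
    rw [inner_sub_right]
    linarith
  have hsum : ∑ i, (c i + ⟪ybar, b i⟫ + a i + ⟪ybar, A i (xbar i) - b i⟫)
      = ⟪ybar, ∑ i, (A i (xbar i) - b i)⟫ := by
    rw [Finset.sum_add_distrib, Finset.sum_add_distrib, hgap, inner_sum]
    ring
  have hzero : ⟪ybar, ∑ i, (A i (xbar i) - b i)⟫ = 0 :=
    le_antisymm hle (hsum ▸ Finset.sum_nonneg fun i _ => hyoung i)
  have heq := (Finset.sum_eq_zero_iff_of_nonneg fun i _ => hyoung i).1 (hsum.trans hzero)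
  refine ⟨fun i => hF i (Finset.mem_univ i), hzero, fun i v => ?_⟩
  by_cases hv : f i v = ⊤
  · rw [hv, EReal.top_add_coe]; exact le_top
  have h1 := hconj i v
  have h2 := heq i (Finset.mem_univ i)
  rw [ha]
  lift f i v to ℝ using ⟨hv, (hproper i).1 v⟩ with g
  rw [hc, ← EReal.coe_sub, EReal.coe_le_coe_iff, inner_neg_left,
    LinearMap.adjoint_inner_left] at h1
  rw [← EReal.coe_add, EReal.coe_le_coe_iff, inner_sub_right]
  rw [inner_sub_right] at h2
  linarith

end ConsensusADMM

/-- **Proposition 2.** Convergence of the decomposed dual consensus ADMM: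
the iterates `yᵢᵏ` and `zᵢᵏ` of Algorithm 3 all converge to the same maximizer
`y*` of the dual problem (D), and every limit point of the concatenated primal
iterates `(xᵢᵏ)ᵢ` is a minimizer of the primal problem (P). -/
theorem decomposed_dual_consensus_admm_convergence
    {N : Type*} [Fintype N] [Nonempty N] {m : ℕ} {n : N → ℕ}
    (G : SimpleGraph N) [DecidableRel G.Adj]
    (hGconn : G.Connected) (hdeg : ∀ i, 1 ≤ G.degree i)
    (f : ∀ i, EuclideanSpace ℝ (Fin (n i)) → EReal)
    (hconv : ∀ i, EConvexFn (f i)) (hlsc : ∀ i, LowerSemicontinuous (f i))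
    (hproper : ∀ i, EProper (f i))
    (A : ∀ i, EuclideanSpace ℝ (Fin (n i)) →ₗ[ℝ] EuclideanSpace ℝ (Fin m))
    (b : N → EuclideanSpace ℝ (Fin m))
    (K : Set (EuclideanSpace ℝ (Fin m)))
    (hne : K.Nonempty) (hcl : IsClosed K) (hKconv : Convex ℝ K)
    (hcone : ∀ c : ℝ, 0 < c → ∀ x ∈ K, c • x ∈ K)
    -- a primal-dual solution exists and the duality gap is zero
    (hgap : ∃ (xbar : ∀ i, EuclideanSpace ℝ (Fin (n i)))
        (ybar : EuclideanSpace ℝ (Fin m)),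
        (∑ i, (A i (xbar i) - b i)) ∈ K ∧ ybar ∈ polarSet K ∧
        (∑ i, f i (xbar i))
          = -(∑ i, (econj (f i) (-(LinearMap.adjoint (A i) ybar))
              + ((⟪ybar, b i⟫ : ℝ) : EReal))) ∧
        (∑ i, f i (xbar i)) ≠ ⊤ ∧ (∑ i, f i (xbar i)) ≠ ⊥)
    (σ ρ : ℝ) (hσ : 0 < σ) (hρ : 0 < ρ)
    (p s r y z : N → ℕ → EuclideanSpace ℝ (Fin m))
    (x : ∀ i, ℕ → EuclideanSpace ℝ (Fin (n i)))
    (hp0 : ∀ i, p i 0 = 0)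
    (hp : ∀ i k, p i (k + 1)
      = p i k + ρ • ∑ j ∈ G.neighborFinset i, (y i k - y j k))
    (hs : ∀ i k, s i (k + 1) = s i k + σ • (y i k - z i k))
    (hr : ∀ i k, r i (k + 1)
      = σ • z i k + ρ • ∑ j ∈ G.neighborFinset i, (y i k + y j k)
        - (b i + p i (k + 1) + s i (k + 1)))
    (hmin : ∀ i k, ∀ xi : EuclideanSpace ℝ (Fin (n i)),
      f i (x i (k + 1)) + (((1 / (2 * (σ + 2 * ρ * (G.degree i : ℝ))))
          * ‖A i (x i (k + 1)) + r i (k + 1)‖ ^ 2 : ℝ) : EReal)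
        ≤ f i xi + (((1 / (2 * (σ + 2 * ρ * (G.degree i : ℝ))))
          * ‖A i xi + r i (k + 1)‖ ^ 2 : ℝ) : EReal))
    (hy : ∀ i k, y i (k + 1)
      = (1 / (σ + 2 * ρ * (G.degree i : ℝ))) • (A i (x i (k + 1)) + r i (k + 1)))
    (hz : ∀ i k, z i (k + 1)
      = projSet (polarSet K) (y i (k + 1) + (1 / σ) • s i (k + 1))) :
    (∃ ystar : EuclideanSpace ℝ (Fin m),
      (ystar ∈ polarSet K ∧
        ∀ y' ∈ polarSet K,
          -(∑ i, (econj (f i) (-(LinearMap.adjoint (A i) y'))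
              + ((⟪y', b i⟫ : ℝ) : EReal)))
            ≤ -(∑ i, (econj (f i) (-(LinearMap.adjoint (A i) ystar))
              + ((⟪ystar, b i⟫ : ℝ) : EReal)))) ∧
      (∀ i, Tendsto (fun k => y i k) atTop (nhds ystar)) ∧
      (∀ i, Tendsto (fun k => z i k) atTop (nhds ystar))) ∧
    (∀ xl : ∀ i, EuclideanSpace ℝ (Fin (n i)),
      MapClusterPt xl atTop (fun k => fun i => x i k) →
      ((∑ i, (A i (xl i) - b i)) ∈ K ∧
        ∀ x' : ∀ i, EuclideanSpace ℝ (Fin (n i)),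
          (∑ i, (A i (x' i) - b i)) ∈ K → (∑ i, f i (xl i)) ≤ ∑ i, f i (x' i))) := by
  classical
  obtain ⟨xbar, ybar, hxK, hyK, hgap, htop, hbot⟩ := hgap
  obtain ⟨hxbar, hcompl, hsubbar⟩ := subgradient_of_zero_gap hproper
    (by rw [real_inner_comm]; exact hyK _ hxK) hgap htop hbot
  have hτ : ∀ i, 0 < σ + 2 * ρ * (G.degree i : ℝ) := fun i => by positivity
  have hopt : ∀ k i, f i (x i (k + 1)) ≠ ⊤ ∧ ∀ v, f i (x i (k + 1))
      ≤ f i v + ((⟪y i (k + 1), A i v - A i (x i (k + 1))⟫ : ℝ) : EReal) := fun k i => by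
    rw [hy i k]
    exact subgradient_of_forall_add_sq_le (hconv i) (hproper i) (A i) (r i (k + 1)) (hτ i)
      (hmin i k)
  -- the multipliers `s` are normal to the dual cone at `z`
  have hcompl_s : ∀ k i, z i (k + 1) ∈ polarSet K ∧ ⟪s i (k + 2), z i (k + 1)⟫ = 0 ∧
      ∀ q ∈ polarSet K, ⟪s i (k + 2), q⟫ ≤ 0 := fun k i => by
    obtain ⟨h1, h2, h3⟩ := projSet_cone_spec ⟨0, zero_mem_polarSet K⟩ (isClosed_polarSet K)
      (convex_polarSet K) (fun c hc q hq => smul_mem_polarSet hc hq)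
      (y i (k + 1) + (1 / σ) • s i (k + 1))
    rw [← hz i k] at h1 h2 h3
    have e : s i (k + 2) = σ • (y i (k + 1) + (1 / σ) • s i (k + 1) - z i (k + 1)) := by
      rw [hs i (k + 1)]
      simp only [smul_sub, smul_add, smul_smul, mul_one_div_cancel hσ.ne', one_smul]
      abel
    refine ⟨h1, ?_, fun q hq => ?_⟩
    · rw [e, inner_smul_left, h2, mul_zero]
    · rw [e, inner_smul_left, conj_trivial]
      exact mul_nonpos_of_nonneg_of_nonpos hσ.le (h3 q hq)
  -- edge flows whose divergence is `p`
  let F : ℕ → N → N → EuclideanSpace ℝ (Fin m) := fun k i j =>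
    if G.Adj i j then ρ • ∑ l ∈ Finset.range k, (y i l - y j l) else 0
  have hpF : ∀ k i, p i k = ∑ j ∈ G.neighborFinset i, F k i j := fun k i => by
    have hF : ∀ j ∈ G.neighborFinset i, F k i j = ρ • ∑ l ∈ Finset.range k, (y i l - y j l) :=
      fun j hj => if_pos (by simpa using hj)
    rw [Finset.sum_congr rfl hF, ← Finset.smul_sum, Finset.sum_comm, Finset.smul_sum]
    induction k with
    | zero => simp [hp0]
    | succ k ih => rw [hp, Finset.sum_range_succ, ← ih fun j hj => if_pos (by simpa using hj)]
  have hiter : IsConsensusIteration G σ ρ (fun k i => y i (k + 1)) (fun k i => z i (k + 1))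
      (fun k i => s i (k + 2)) (fun k i => A i (x i (k + 1)) - b i) (fun k => F (k + 2)) :=
    { S_succ := fun k i => hs i (k + 2)
      F_succ := fun k i j hij => by
        simp only [F, if_pos hij]
        rw [Finset.sum_range_succ _ (k + 2), smul_add]
      F_antisymm := fun k i j => by
        by_cases hij : G.Adj i j
        · simp only [F, if_pos hij, if_pos hij.symm]
          rw [← smul_neg, ← Finset.sum_neg_distrib]
          simp only [neg_sub]
        · have hji : ¬G.Adj j i := fun h => hij h.symm
          simp only [F, if_neg hij, if_neg hji, neg_zero]
      F_nonadj := fun k i j hij => if_neg hij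
      U_succ := fun k i => by
        have e1 : A i (x i (k + 2)) = (σ + 2 * ρ * (G.degree i : ℝ)) • y i (k + 2)
            - r i (k + 2) := by
          rw [hy i (k + 1), smul_smul, mul_one_div_cancel (hτ i).ne', one_smul]
          abel
        have e2 : ∀ v : EuclideanSpace ℝ (Fin m), ∑ _j ∈ G.neighborFinset i, v
            = (G.degree i : ℝ) • v := fun v => by
          rw [Finset.sum_const, G.card_neighborFinset_eq_degree, Nat.cast_smul_eq_nsmul]
        simp only [show k + 1 + 1 = k + 2 from rfl]
        rw [e1, hr i (k + 1), ← hpF (k + 1 + 2) i, hp i (k + 2), hs i (k + 2)]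
        simp only [Finset.sum_add_distrib, Finset.sum_sub_distrib, e2,
          show k + 1 + 1 = k + 2 from rfl]
        module
      mono_U := fun k l i => by
        rw [sub_sub_sub_cancel_right]
        exact inner_sub_nonpos_of_subgradient ⟨(hproper i).1 _, (hopt k i).1⟩
          ⟨(hproper i).1 _, (hopt l i).1⟩ ((hopt k i).2 _) ((hopt l i).2 _)
      mono_S := fun k l i => by
        obtain ⟨hk1, hk2, hk3⟩ := hcompl_s k i
        obtain ⟨hl1, hl2, hl3⟩ := hcompl_s l i
        have h1 := hk3 _ hl1
        have h2 := hl3 _ hk1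
        rw [real_inner_comm, inner_sub_left, inner_sub_right, inner_sub_right]
        linarith }
  -- a stationary point from the given primal-dual solution
  set ubar := ∑ i, (A i (xbar i) - b i) with hubar
  have hN : (Fintype.card N : ℝ) ≠ 0 := by exact_mod_cast Fintype.card_ne_zero
  obtain ⟨Fbar, hFbar, hdiv⟩ := hGconn.exists_flow
    (fun i => A i (xbar i) - b i - (1 / (Fintype.card N : ℝ)) • ubar) (by
      rw [Finset.sum_sub_distrib, Finset.sum_const, Finset.card_univ,
        ← Nat.cast_smul_eq_nsmul ℝ, smul_smul, mul_one_div_cancel hN, one_smul, sub_self])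
  have hstat : IsConsensusStationary G (fun k i => y i (k + 1)) (fun k i => z i (k + 1))
      (fun k i => s i (k + 2)) (fun k i => A i (x i (k + 1)) - b i) ybar
      (fun _ => (1 / (Fintype.card N : ℝ)) • ubar) Fbar :=
    { antisymm := hFbar
      mono_U := fun k i => by
        rw [hdiv, add_sub_cancel, sub_sub_sub_cancel_right]
        exact inner_sub_nonpos_of_subgradient ⟨(hproper i).1 _, (hopt k i).1⟩
          ⟨(hproper i).1 _, hxbar i⟩ ((hopt k i).2 _) (hsubbar i _)
      mono_S := fun k i => by
        obtain ⟨hk1, hk2, hk3⟩ := hcompl_s k i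
        have h1 := hk3 _ hyK
        have h2 := hk1 _ hxK
        rw [real_inner_comm, inner_sub_left, inner_sub_right, inner_sub_right, inner_smul_left,
          inner_smul_left, real_inner_comm ybar ubar, hcompl, conj_trivial]
        have h3 : 1 / (Fintype.card N : ℝ) * ⟪ubar, z i (k + 1)⟫ ≤ 0 :=
          mul_nonpos_of_nonneg_of_nonpos (by positivity) h2
        linarith }
  obtain ⟨ystar, sstar, ustar, hY, hZ, hS, hU, hsum⟩ :=
    hiter.exists_tendsto hGconn hσ hρ hstat
  obtain ⟨o⟩ := ‹Nonempty N›
  have hystar : ystar ∈ polarSet K := (isClosed_polarSet K).mem_of_tendsto (hZ o)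
    (Eventually.of_forall fun k => (hcompl_s k o).1)
  have hs_le : ∀ q ∈ polarSet K, ⟪∑ i, sstar i, q⟫ ≤ 0 := fun q hq => by
    rw [sum_inner]
    exact Finset.sum_nonpos fun i _ => le_of_tendsto ((hS i).inner tendsto_const_nhds)
      (Eventually.of_forall fun k => (hcompl_s k i).2.2 q hq)
  have hs_zero : ⟪∑ i, sstar i, ystar⟫ = 0 := by
    rw [sum_inner]
    exact Finset.sum_eq_zero fun i _ => tendsto_nhds_unique ((hS i).inner (hZ i))
      (tendsto_const_nhds.congr fun k => (hcompl_s k i).2.1.symm)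
  refine ⟨⟨ystar, ⟨hystar, fun y' hy' => EReal.neg_le_neg_iff.2 ?_⟩,
    fun i => (tendsto_add_atTop_iff_nat 1).1 (hY i),
    fun i => (tendsto_add_atTop_iff_nat 1).1 (hZ i)⟩, fun xl hxl => ?_⟩
  · calc _ ≤ ∑ i, (econj (f i) (-(LinearMap.adjoint (A i) y')) + ((⟪y', b i⟫ : ℝ) : EReal)
          + ((⟪y' - ystar, ustar i⟫ : ℝ) : EReal)) :=
        Finset.sum_le_sum fun i _ => econj_adjoint_add_le_of_tendsto (hproper i) (hU i) (hY i)
          (fun k => (hopt k i).1) (fun k => (hopt k i).2) y'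
      _ = ∑ i, (econj (f i) (-(LinearMap.adjoint (A i) y')) + ((⟪y', b i⟫ : ℝ) : EReal))
          + ((⟪y' - ystar, ∑ i, sstar i⟫ : ℝ) : EReal) := by
        rw [Finset.sum_add_distrib, ← EReal.coe_finset_sum, ← inner_sum, hsum]
      _ ≤ _ := by
        refine add_le_of_le_of_nonpos le_rfl (EReal.coe_nonpos.2 ?_)
        rw [real_inner_comm, inner_sub_right, hs_zero, sub_zero]
        exact hs_le y' hy'
  · obtain ⟨ψ, hψ, hlim⟩ := hxl.tendsto_subseq
    have hχ : Tendsto (fun k => ψ (k + 1) - 1) atTop atTop :=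
      (tendsto_sub_atTop_nat 1).comp (hψ.tendsto_atTop.comp (tendsto_add_atTop_nat 1))
    have hψ1 : ∀ k, ψ (k + 1) - 1 + 1 = ψ (k + 1) := fun k =>
      Nat.sub_add_cancel ((Nat.succ_pos k).trans_le (hψ.id_le (k + 1)))
    have hx : ∀ i, Tendsto (fun k => x i (ψ (k + 1) - 1 + 1)) atTop (𝓝 (xl i)) := fun i => by
      simp only [hψ1]
      exact ((tendsto_pi_nhds.1 hlim) i).comp (tendsto_add_atTop_nat 1)
    have hAx : ∀ i, A i (xl i) - b i = ustar i := fun i =>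
      tendsto_nhds_unique ((((A i).continuous_of_finiteDimensional.tendsto _).comp
        (hx i)).sub_const (b i)) ((hU i).comp hχ)
    have hfeas : ∑ i, (A i (xl i) - b i) = ∑ i, sstar i := by
      rw [← hsum]
      exact Finset.sum_congr rfl fun i _ => hAx i
    refine ⟨?_, fun x' hx' => ?_⟩
    · rw [hfeas]
      exact mem_of_forall_polarSet_inner_nonpos hne hcl hKconv hcone hs_le
    · calc ∑ i, f i (xl i)
          ≤ ∑ i, (f i (x' i) + ((⟪ystar, A i (x' i) - A i (xl i)⟫ : ℝ) : EReal)) :=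
          Finset.sum_le_sum fun i _ => subgradient_of_tendsto (hlsc i) (hproper i) (hx i)
            ((hY i).comp hχ) (fun k => (hopt _ i).2) (x' i)
        _ = ∑ i, f i (x' i) + ((⟪ystar, ∑ i, (A i (x' i) - b i) - ∑ i, sstar i⟫ : ℝ) : EReal) := by
          rw [Finset.sum_add_distrib, ← EReal.coe_finset_sum, ← inner_sum, ← hfeas,
            ← Finset.sum_sub_distrib]
          simp only [sub_sub_sub_cancel_right]
        _ ≤ _ := by
          refine add_le_of_le_of_nonpos le_rfl (EReal.coe_nonpos.2 ?_)
          rw [real_inner_comm, inner_sub_left, hs_zero, sub_zero]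
          exact hystar _ hx'
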